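/- There exists a constant C > 0 such that the following holds. Let G = (V,E) be a finite simple connected undirected graph on n ≥ 2 vertices with vertex expansion φ, let f : V → {1,…,n} be a valuation, and let A = T_f be the convergence time random variable of the asynchronous maximum model started from f. Then for every a > 0, P(|A − E[A]| ≥ a) ≤ C·(n/φ)²·(log n)² / a². Consequently, for any function g with 1/g(n)² → 0 as n → ∞, the number of rounds until convergence is O((n/φ)·(log n)·g(n)) with high probability. -/

import Mathlib

open MeasureTheory
open scoped ENNReal

attribute [local instance] Classical.propDecidable

/-- The neighbours of `v` in `G`, as a finset. -/
noncomputable def nbrs {V : Type*} [Fintype V] (G : SimpleGraph V) (v : V) : Finset V :=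
  Finset.univ.filter (fun u => G.Adj v u)

/-- The asynchronous maximum update of a valuation `f` at the vertex `v`:
the value at `v` is replaced by the maximum of `f` over the neighbours of `v`
(if `v` has at least one neighbour; otherwise nothing changes), and all other
values are unchanged. -/
noncomputable def amUpdate {V : Type*} [Fintype V] (G : SimpleGraph V)
    (f : V → ℕ) (v : V) : V → ℕ :=
  fun u => if u = v ∧ (nbrs G v).Nonempty then (nbrs G v).sup f else f u

/-- The asynchronous maximum model: starting from the valuation `f`, at round `t` the vertex
`ω t` is chosen and updated. `amRun G f ω t` is the valuation after `t` rounds. -/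
noncomputable def amRun {V : Type*} [Fintype V] (G : SimpleGraph V)
    (f : V → ℕ) (ω : ℕ → V) : ℕ → V → ℕ
  | 0 => f
  | (t + 1) => amUpdate G (amRun G f ω t) (ω t)

/-- The convergence time along the update sequence `ω`: the least `t` such that the valuation
after `t` rounds is constant, and `∞` if no such `t` exists (as a value in `ℝ≥0∞`). -/
noncomputable def convTime {V : Type*} [Fintype V] (G : SimpleGraph V)
    (f : V → ℕ) (ω : ℕ → V) : ℝ≥0∞ :=
  ⨅ (t : ℕ) (_ : ∃ c : ℕ, amRun G f ω t = fun _ => c), (t : ℝ≥0∞)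

/-- `μ` is the infinite product of uniform measures on `V`: a probability measure on `ℕ → V`
under which the coordinates are independent and uniformly distributed on `V`, i.e. every
cylinder fixing the first `m` coordinates has measure `(1/|V|)^m`. -/
def IsUniformProduct {V : Type*} [Fintype V] [MeasurableSpace V]
    (μ : Measure (ℕ → V)) : Prop :=
  IsProbabilityMeasure μ ∧
    ∀ (m : ℕ) (g : ℕ → V),
      μ {ω | ∀ i < m, ω i = g i} = (1 / (Fintype.card V : ℝ≥0∞)) ^ m

/-- The boundary of a finset `A` in an undirected graph `G`:
the vertices outside `A` with a neighbour in `A`. -/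
noncomputable def vBoundary {V : Type*} [Fintype V] (G : SimpleGraph V)
    (A : Finset V) : Finset V :=
  Finset.univ.filter (fun v => v ∉ A ∧ ∃ u ∈ A, G.Adj u v)

/-- The vertex expansion `φ(G)`: the minimum of `|Γ(A)|/|A|` over all nonempty vertex sets `A`
with `|A| ≤ n/2`. -/
noncomputable def vertexExpansion {V : Type*} [Fintype V] (G : SimpleGraph V) : ℝ :=
  sInf {r : ℝ | ∃ A : Finset V, A.Nonempty ∧ 2 * A.card ≤ Fintype.card V ∧
    r = (vBoundary G A).card / A.card}

/-- The effect of an asynchronous maximum update at `v` on a superlevel set `A`. -/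
noncomputable def levelStep {V : Type*} [Fintype V] (G : SimpleGraph V)
    (A : Finset V) (v : V) : Finset V :=
  if ∃ u ∈ A, G.Adj v u then insert v A else A.erase v

/-- The vertices of `A` having a neighbour in `A`. -/
noncomputable def core {V : Type*} [Fintype V] (G : SimpleGraph V) (A : Finset V) : Finset V :=
  A.filter (fun v => ∃ u ∈ A, G.Adj v u)

/-- The potential of a superlevel set. -/
noncomputable def levelPotential {V : Type*} [Fintype V] (G : SimpleGraph V)
    (A : Finset V) : ℝ :=
  if core G A = ∅ then (Fintype.card V : ℝ) * A.card
  else ((Fintype.card V : ℝ) - (core G A).card) / (core G A).card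

section
variable {V : Type*} [Fintype V] {G : SimpleGraph V}

lemma core_subset (A : Finset V) : core G A ⊆ A := Finset.filter_subset _ _

lemma mem_core {A : Finset V} {v : V} : v ∈ core G A ↔ v ∈ A ∧ ∃ u ∈ A, G.Adj v u := by
  simp [core]

lemma core_mono {A B : Finset V} (h : A ⊆ B) : core G A ⊆ core G B := by
  intro v hv
  obtain ⟨h1, u, hu, huv⟩ := mem_core.1 hv
  exact mem_core.2 ⟨h h1, u, h hu, huv⟩

lemma core_subset_core_levelStep (A : Finset V) (v : V) :
    core G A ⊆ core G (levelStep G A v) := by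
  unfold levelStep
  split_ifs with h
  · exact core_mono (Finset.subset_insert _ _)
  · intro w hw
    obtain ⟨h1, u, hu, hwu⟩ := mem_core.1 hw
    refine mem_core.2 ⟨Finset.mem_erase.2 ⟨?_, h1⟩, u, Finset.mem_erase.2 ⟨?_, hu⟩, hwu⟩
    · rintro rfl
      exact h ⟨u, hu, hwu⟩
    · rintro rfl
      exact h ⟨w, h1, hwu.symm⟩

lemma mem_vBoundary {A : Finset V} {v : V} :
    v ∈ vBoundary G A ↔ v ∉ A ∧ ∃ u ∈ A, G.Adj u v := by
  simp [vBoundary]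

lemma insert_core_subset_core_levelStep {A : Finset V} {v : V}
    (hv : v ∈ vBoundary G (core G A)) : insert v (core G A) ⊆ core G (levelStep G A v) := by
  obtain ⟨-, u, hu, huv⟩ := mem_vBoundary.1 hv
  have huA := core_subset A hu
  refine Finset.insert_subset ?_ (core_subset_core_levelStep A v)
  rw [levelStep, if_pos ⟨u, huA, huv.symm⟩]
  exact mem_core.2 ⟨Finset.mem_insert_self _ _, u, Finset.mem_insert_of_mem huA, huv.symm⟩

lemma vertexExpansion_bddBelow : BddBelow {r : ℝ | ∃ A : Finset V, A.Nonempty ∧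
    2 * A.card ≤ Fintype.card V ∧ r = (vBoundary G A).card / A.card} := by
  refine ⟨0, ?_⟩
  rintro r ⟨A, -, -, rfl⟩
  positivity

lemma vertexExpansion_mul_card_le {A : Finset V} (hA : 2 * A.card ≤ Fintype.card V) :
    vertexExpansion G * A.card ≤ (vBoundary G A).card := by
  rcases A.eq_empty_or_nonempty with rfl | hne
  · simp
  · have hpos : (0 : ℝ) < A.card := by exact_mod_cast hne.card_pos
    rw [← le_div_iff₀ hpos]
    exact csInf_le vertexExpansion_bddBelow ⟨A, hne, hA, rfl⟩

lemma exists_card_half (hn : 2 ≤ Fintype.card V) :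
    ∃ A : Finset V, A.Nonempty ∧ 2 * A.card ≤ Fintype.card V ∧ Fintype.card V ≤ 3 * A.card := by
  obtain ⟨A, -, hA⟩ := Finset.exists_subset_card_eq
    (s := (Finset.univ : Finset V)) (n := Fintype.card V / 2) (by
      rw [Finset.card_univ]; omega)
  exact ⟨A, Finset.card_pos.1 (by omega), by omega, by omega⟩

lemma vBoundary_nonempty (hG : G.Connected) {A : Finset V} (hA : A.Nonempty)
    (hA' : A ≠ Finset.univ) : (vBoundary G A).Nonempty := by
  obtain ⟨u, hu⟩ := hA
  obtain ⟨w, hw⟩ : ∃ w, w ∉ A := by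
    by_contra! h
    exact hA' (Finset.eq_univ_of_forall h)
  obtain ⟨p⟩ := hG.preconnected u w
  obtain ⟨d, -, hd1, hd2⟩ := p.exists_boundary_dart (A : Set V) (by simpa) (by simpa)
  exact ⟨d.snd, mem_vBoundary.2 ⟨by simpa using hd2, d.fst, by simpa using hd1, d.adj⟩⟩

lemma vertexExpansion_pos (hG : G.Connected) (hn : 2 ≤ Fintype.card V) :
    0 < vertexExpansion G := by
  have hc : (0 : ℝ) < Fintype.card V := by exact_mod_cast (by omega : 0 < Fintype.card V)
  obtain ⟨A, h1, h2, -⟩ := exists_card_half hn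
  refine lt_of_lt_of_le (one_div_pos.2 hc) (le_csInf ⟨_, A, h1, h2, rfl⟩ ?_)
  rintro r ⟨A, h1, h2, rfl⟩
  have hb : (1 : ℝ) ≤ (vBoundary G A).card := by
    exact_mod_cast (vBoundary_nonempty hG h1 (by
      rintro rfl
      rw [Finset.card_univ] at h2
      omega)).card_pos
  have hA : (0 : ℝ) < A.card := by exact_mod_cast h1.card_pos
  have hAn : (A.card : ℝ) ≤ Fintype.card V := by exact_mod_cast Finset.card_le_univ A
  gcongr

lemma vertexExpansion_le_two (hn : 2 ≤ Fintype.card V) : vertexExpansion G ≤ 2 := by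
  obtain ⟨A, h1, h2, h3⟩ := exists_card_half hn
  have h := vertexExpansion_mul_card_le (G := G) h2
  have hA : (0 : ℝ) < A.card := by exact_mod_cast h1.card_pos
  have hd : Disjoint (vBoundary G A) A :=
    Finset.disjoint_left.2 fun v hv => (mem_vBoundary.1 hv).1
  have hcard := Finset.card_le_univ (vBoundary G A ∪ A)
  rw [Finset.card_union_of_disjoint hd] at hcard
  have : ((vBoundary G A).card : ℝ) ≤ 2 * A.card := by
    exact_mod_cast (by omega : (vBoundary G A).card ≤ 2 * A.card)
  exact le_of_mul_le_mul_right (h.trans this) hA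

/-- The expansion bound for sets of arbitrary size. -/
lemma card_mul_card_compl_le_card_vBoundary (hG : G.Connected) (hn : 2 ≤ Fintype.card V)
    (B : Finset V) :
    vertexExpansion G * (B.card * (Fintype.card V - B.card)) ≤
      3 * Fintype.card V * (vBoundary G B).card := by
  have hφ := vertexExpansion_pos hG hn
  have hφ2 := vertexExpansion_le_two (G := G) hn
  have hn0 : (0 : ℝ) < Fintype.card V := by exact_mod_cast (by omega : 0 < Fintype.card V)
  have hBn : (B.card : ℝ) ≤ Fintype.card V := by exact_mod_cast Finset.card_le_univ B
  have hB0 : (0 : ℝ) ≤ B.card := by positivity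
  have hΓ0 : (0 : ℝ) ≤ (vBoundary G B).card := by positivity
  by_cases hB : 2 * B.card ≤ Fintype.card V
  · have h := vertexExpansion_mul_card_le (G := G) hB
    nlinarith [mul_le_mul h (sub_le_self (Fintype.card V : ℝ) hB0) (sub_nonneg.2 hBn) hΓ0,
      mul_nonneg hn0.le hΓ0]
  · set W : Finset V := (B ∪ vBoundary G B)ᶜ with hW
    have hd : Disjoint B (vBoundary G B) :=
      Finset.disjoint_right.2 fun v hv => (mem_vBoundary.1 hv).1
    have hcard : B.card + (vBoundary G B).card + W.card = Fintype.card V := by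
      rw [← Finset.card_union_of_disjoint hd, hW, Finset.card_add_card_compl]
    have h := vertexExpansion_mul_card_le (G := G) (A := W) (by omega)
    have hsub : vBoundary G W ⊆ vBoundary G B := by
      intro v hv
      obtain ⟨hvW, u, hu, huv⟩ := mem_vBoundary.1 hv
      simp only [hW, Finset.mem_compl, Finset.mem_union, not_or] at hvW hu
      by_contra hvB
      have hvB' : v ∈ B := by tauto
      exact hu.2 (mem_vBoundary.2 ⟨hu.1, v, hvB', huv.symm⟩)
    have hsub' : ((vBoundary G W).card : ℝ) ≤ (vBoundary G B).card := by
      exact_mod_cast Finset.card_le_card hsub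
    have hcard' : (B.card : ℝ) + (vBoundary G B).card + W.card = Fintype.card V := by
      exact_mod_cast hcard
    have key : vertexExpansion G * (Fintype.card V - B.card) ≤ 3 * (vBoundary G B).card := by
      rw [← hcard']
      nlinarith
    have := mul_le_mul key hBn hB0 (by positivity)
    linarith

lemma levelPotential_nonneg (A : Finset V) : 0 ≤ levelPotential G A := by
  unfold levelPotential
  split_ifs
  · positivity
  · have : ((core G A).card : ℝ) ≤ Fintype.card V := by exact_mod_cast Finset.card_le_univ _
    exact div_nonneg (by linarith) (by positivity)

lemma levelPotential_le_of_card_core {A : Finset V} {b : ℕ} (hb : 0 < b)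
    (h : b ≤ (core G A).card) :
    levelPotential G A ≤ ((Fintype.card V : ℝ) - b) / b := by
  have hne : core G A ≠ ∅ := by
    rw [← Finset.card_pos.trans Finset.nonempty_iff_ne_empty]
    omega
  have hb' : (0 : ℝ) < b := by exact_mod_cast hb
  have h' : (b : ℝ) ≤ (core G A).card := by exact_mod_cast h
  have hn : ((core G A).card : ℝ) ≤ Fintype.card V := by exact_mod_cast Finset.card_le_univ _
  rw [levelPotential, if_neg hne]
  exact div_le_div₀ (by linarith) (by linarith) hb' h'

lemma levelPotential_le {A : Finset V} (hA : A.Nonempty) :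
    levelPotential G A ≤ (Fintype.card V : ℝ) * A.card := by
  by_cases h : core G A = ∅
  · rw [levelPotential, if_pos h]
  · have h1 : (1 : ℝ) ≤ A.card := by exact_mod_cast hA.card_pos
    have := levelPotential_le_of_card_core (G := G) (A := A) (b := 1) one_pos
      (Finset.card_pos.2 (Finset.nonempty_iff_ne_empty.2 h))
    norm_num at this
    have hn : (0 : ℝ) ≤ Fintype.card V := by positivity
    nlinarith

lemma levelPotential_le_sq (A : Finset V) :
    levelPotential G A ≤ (Fintype.card V : ℝ) ^ 2 := by
  rcases A.eq_empty_or_nonempty with rfl | hA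
  · simp [levelPotential, core]
  · have : (A.card : ℝ) ≤ Fintype.card V := by exact_mod_cast Finset.card_le_univ _
    refine (levelPotential_le hA).trans ?_
    rw [sq]
    gcongr

lemma one_le_card_mul_levelPotential {A : Finset V} (hA : A.Nonempty) (hA' : A ≠ Finset.univ) :
    1 ≤ Fintype.card V * levelPotential G A := by
  have hlt : A.card + 1 ≤ Fintype.card V := Finset.card_lt_univ_of_notMem
    (Classical.choose_spec (by
      by_contra! h
      exact hA' (Finset.eq_univ_of_forall h) : ∃ x, x ∉ A))
  have hlt' : (A.card : ℝ) + 1 ≤ Fintype.card V := by exact_mod_cast hlt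
  have h1 : (1 : ℝ) ≤ A.card := by exact_mod_cast hA.card_pos
  unfold levelPotential
  split_ifs with h
  · have hn1 : (1 : ℝ) ≤ Fintype.card V := by linarith
    exact one_le_mul_of_one_le_of_one_le hn1 (one_le_mul_of_one_le_of_one_le hn1 h1)
  · have hb : (0 : ℝ) < (core G A).card := by
      exact_mod_cast Finset.card_pos.2 (Finset.nonempty_iff_ne_empty.2 h)
    have hbA : ((core G A).card : ℝ) ≤ A.card := by
      exact_mod_cast Finset.card_le_card (core_subset A)
    rw [← mul_div_assoc, one_le_div hb]
    nlinarith

lemma levelPotential_levelStep_le {A : Finset V} (hA : core G A = ∅) (v : V) :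
    levelPotential G (levelStep G A v) ≤
      levelPotential G A - if v ∈ A then (Fintype.card V : ℝ) else 0 := by
  have hP : levelPotential G A = Fintype.card V * A.card := if_pos hA
  rw [hP]
  by_cases h : ∃ u ∈ A, G.Adj v u
  · have hv : v ∉ A := fun hv => by
      have := mem_core.2 ⟨hv, h⟩
      simp [hA] at this
    obtain ⟨u, hu, huv⟩ := h
    have hne : 1 ≤ (core G (levelStep G A v)).card := by
      refine Finset.card_pos.2 ⟨v, ?_⟩
      rw [levelStep, if_pos ⟨u, hu, huv⟩]
      exact mem_core.2 ⟨Finset.mem_insert_self _ _, u, Finset.mem_insert_of_mem hu, huv⟩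
    have := levelPotential_le_of_card_core one_pos hne
    have h1 : (1 : ℝ) ≤ A.card := by exact_mod_cast Finset.card_pos.2 ⟨u, hu⟩
    have hn : (0 : ℝ) ≤ Fintype.card V := by positivity
    norm_num at this
    rw [if_neg hv]
    nlinarith
  · have hc : core G (A.erase v) = ∅ :=
      Finset.subset_empty.1 (hA ▸ core_mono (Finset.erase_subset _ _))
    rw [levelStep, if_neg h, levelPotential, if_pos hc]
    split_ifs with hv
    · rw [← Finset.card_erase_add_one hv]
      push_cast
      linarith
    · rw [Finset.erase_eq_of_notMem hv]
      linarith

/-- One round decreases the expected potential of a superlevel set by a constant factor. -/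
lemma sum_levelPotential_levelStep_le (hG : G.Connected) (hn : 2 ≤ Fintype.card V)
    (A : Finset V) :
    ∑ v, levelPotential G (levelStep G A v) ≤
      (Fintype.card V - vertexExpansion G / 6) * levelPotential G A := by
  have hφ2 := vertexExpansion_le_two (G := G) hn
  have hP := levelPotential_nonneg (G := G) A
  by_cases h : core G A = ∅
  · calc ∑ v, levelPotential G (levelStep G A v)
        ≤ ∑ v, (levelPotential G A - if v ∈ A then (Fintype.card V : ℝ) else 0) :=
          Finset.sum_le_sum fun v _ => levelPotential_levelStep_le h v
      _ = Fintype.card V * levelPotential G A - levelPotential G A := by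
          rw [Finset.sum_sub_distrib, Finset.sum_ite_mem, Finset.univ_inter, Finset.sum_const,
            Finset.sum_const, Finset.card_univ, nsmul_eq_mul, nsmul_eq_mul,
            show levelPotential G A = Fintype.card V * A.card from if_pos h]
          ring
      _ ≤ _ := by nlinarith
  · have hexp := card_mul_card_compl_le_card_vBoundary hG hn (core G A)
    set b := (core G A).card with hb
    have hb0 : 0 < b := Finset.card_pos.2 (Finset.nonempty_iff_ne_empty.2 h)
    have hb1 : (1 : ℝ) ≤ b := by exact_mod_cast hb0
    have hPA : levelPotential G A = (Fintype.card V - b) / b := if_neg h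
    have hn0 : (0 : ℝ) < Fintype.card V := by exact_mod_cast (by omega : 0 < Fintype.card V)
    have hbn : (b : ℝ) ≤ Fintype.card V := by exact_mod_cast Finset.card_le_univ _
    have hstep : ∀ v, levelPotential G (levelStep G A v) ≤ levelPotential G A -
        if v ∈ vBoundary G (core G A) then (Fintype.card V : ℝ) / (b * (b + 1)) else 0 := by
      intro v
      split_ifs with hv
      · have hc : b + 1 ≤ (core G (levelStep G A v)).card := by
          rw [hb, ← Finset.card_insert_of_notMem (mem_vBoundary.1 hv).1]
          exact Finset.card_le_card (insert_core_subset_core_levelStep hv)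
        refine (levelPotential_le_of_card_core (Nat.succ_pos b) hc).trans (le_of_eq ?_)
        rw [hPA]
        push_cast
        field_simp
        ring
      · rw [sub_zero, hPA]
        exact levelPotential_le_of_card_core hb0
          (Finset.card_le_card (core_subset_core_levelStep A v))
    calc ∑ v, levelPotential G (levelStep G A v)
        ≤ ∑ v, (levelPotential G A - if v ∈ vBoundary G (core G A) then
            (Fintype.card V : ℝ) / (b * (b + 1)) else 0) := Finset.sum_le_sum fun v _ => hstep v
      _ = Fintype.card V * levelPotential G A -
            (vBoundary G (core G A)).card * ((Fintype.card V : ℝ) / (b * (b + 1))) := by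
          rw [Finset.sum_sub_distrib, Finset.sum_ite_mem, Finset.univ_inter, Finset.sum_const,
            Finset.sum_const, Finset.card_univ, nsmul_eq_mul, nsmul_eq_mul]
      _ ≤ _ := by
          rw [sub_mul]
          refine sub_le_sub_left ?_ _
          rw [hPA, ← mul_div_assoc, ← mul_div_assoc, div_le_div_iff₀ (by positivity) (by positivity)]
          have hφ := vertexExpansion_pos hG hn
          have h1 : vertexExpansion G * (Fintype.card V - b) * (b + 1) ≤
              2 * (vertexExpansion G * (b * (Fintype.card V - b))) := by
            have : 0 ≤ vertexExpansion G * (Fintype.card V - b) :=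
              mul_nonneg hφ.le (by linarith)
            nlinarith
          nlinarith

/-- The superlevel set of `f` at height `k`. -/
noncomputable def superlevel (f : V → ℕ) (k : ℕ) : Finset V :=
  Finset.univ.filter (fun v => k ≤ f v)

lemma mem_superlevel {f : V → ℕ} {k : ℕ} {v : V} : v ∈ superlevel f k ↔ k ≤ f v := by
  simp [superlevel]

lemma nbrs_nonempty (hG : G.Connected) (hn : 2 ≤ Fintype.card V) (v : V) :
    (nbrs G v).Nonempty := by
  have : Nontrivial V := Fintype.one_lt_card_iff_nontrivial.1 hn
  obtain ⟨u, hu⟩ := hG.preconnected.exists_adj_of_nontrivial v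
  exact ⟨u, by simpa [nbrs] using hu⟩

lemma superlevel_amUpdate (hG : G.Connected) (hn : 2 ≤ Fintype.card V) (f : V → ℕ) (v : V)
    {k : ℕ} (hk : 0 < k) :
    superlevel (amUpdate G f v) k = levelStep G (superlevel f k) v := by
  ext u
  rw [mem_superlevel, amUpdate, levelStep]
  simp only [nbrs_nonempty hG hn v, and_true, mem_superlevel]
  by_cases huv : u = v
  · subst huv
    rw [if_pos rfl, Finset.le_sup_iff (by simpa using hk)]
    split_ifs with h
    · obtain ⟨w, hw, huw⟩ := h
      simp only [Finset.mem_insert_self, iff_true]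
      exact ⟨w, by simpa [nbrs] using huw, hw⟩
    · simp only [Finset.mem_erase, ne_eq, not_true_eq_false, false_and, iff_false]
      rintro ⟨w, hw, hkw⟩
      exact h ⟨w, hkw, by simpa [nbrs] using hw⟩
  · rw [if_neg huv]
    split_ifs with h
    · simp [huv, mem_superlevel]
    · simp [huv, mem_superlevel]

lemma amUpdate_le {f : V → ℕ} {n : ℕ} (hf : ∀ v, f v ≤ n) (v u : V) :
    amUpdate G f v u ≤ n := by
  unfold amUpdate
  split_ifs
  · exact Finset.sup_le fun w _ => hf w
  · exact hf u

lemma amRun_le {f : V → ℕ} {n : ℕ} (hf : ∀ v, f v ≤ n) (ω : ℕ → V) (t : ℕ) (u : V) :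
    amRun G f ω t u ≤ n := by
  induction t generalizing u with
  | zero => exact hf u
  | succ t ih => exact amUpdate_le ih _ _

/-- The potential of a valuation: the sum of the potentials of its superlevel sets. -/
noncomputable def potential (G : SimpleGraph V) (f : V → ℕ) : ℝ :=
  ∑ k ∈ Finset.Icc 1 (Fintype.card V), levelPotential G (superlevel f k)

lemma potential_nonneg (f : V → ℕ) : 0 ≤ potential G f :=
  Finset.sum_nonneg fun _ _ => levelPotential_nonneg _

lemma potential_le (f : V → ℕ) : potential G f ≤ (Fintype.card V : ℝ) ^ 3 := by
  refine (Finset.sum_le_sum fun k _ => levelPotential_le_sq (superlevel f k)).trans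
    (le_of_eq ?_)
  rw [Finset.sum_const, Nat.card_Icc, nsmul_eq_mul]
  push_cast [Nat.add_sub_cancel]
  ring

lemma sum_potential_amUpdate_le (hG : G.Connected) (hn : 2 ≤ Fintype.card V) (f : V → ℕ) :
    ∑ v, potential G (amUpdate G f v) ≤
      (Fintype.card V - vertexExpansion G / 6) * potential G f := by
  unfold potential
  rw [Finset.sum_comm, Finset.mul_sum]
  refine Finset.sum_le_sum fun k hk => ?_
  simp only [superlevel_amUpdate hG hn f _ (Finset.mem_Icc.1 hk).1]
  exact sum_levelPotential_levelStep_le hG hn _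

lemma one_le_card_mul_potential {f : V → ℕ} (hf : ∀ v, f v ≤ Fintype.card V)
    (hne : ¬ ∃ c : ℕ, f = fun _ => c) : 1 ≤ Fintype.card V * potential G f := by
  obtain ⟨u, w, huw⟩ : ∃ u w, f u < f w := by
    by_contra! h
    rcases isEmpty_or_nonempty V with hV | ⟨⟨u⟩⟩
    · exact hne ⟨0, Subsingleton.elim _ _⟩
    · exact hne ⟨f u, funext fun w => le_antisymm (h _ _) (h _ _)⟩
  refine (one_le_card_mul_levelPotential (G := G) (A := superlevel f (f w))
    ⟨w, mem_superlevel.2 le_rfl⟩ fun h => ?_).trans ?_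
  · have := mem_superlevel.1 (h ▸ Finset.mem_univ u)
    omega
  · gcongr
    exact Finset.single_le_sum (f := fun k => levelPotential G (superlevel f k))
      (fun _ _ => levelPotential_nonneg _) (Finset.mem_Icc.2 ⟨by omega, hf w⟩)

/-- Extend a finite sequence to an infinite one by a constant. -/
noncomputable def extendSeq (v₀ : V) {t : ℕ} (g : Fin t → V) (i : ℕ) : V :=
  if h : i < t then g ⟨i, h⟩ else v₀

lemma amRun_congr (f : V → ℕ) {ω ω' : ℕ → V} {t : ℕ} (h : ∀ i < t, ω i = ω' i) :
    amRun G f ω t = amRun G f ω' t := by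
  induction t with
  | zero => rfl
  | succ t ih => rw [amRun, amRun, ih fun i hi => h i (by omega), h t (by omega)]

lemma amRun_extendSeq_restrict (f : V → ℕ) (v₀ : V) (ω : ℕ → V) (t : ℕ) :
    amRun G f (extendSeq v₀ fun i : Fin t => ω i) t = amRun G f ω t :=
  amRun_congr f fun i hi => by simp [extendSeq, hi]

lemma amRun_extendSeq_snoc (f : V → ℕ) (v₀ v : V) {t : ℕ} (g : Fin t → V) :
    amRun G f (extendSeq v₀ (Fin.snoc (α := fun _ => V) g v)) (t + 1) =
      amUpdate G (amRun G f (extendSeq v₀ g) t) v := by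
  rw [amRun]
  congr 1
  · refine amRun_congr f fun i hi => ?_
    simp [extendSeq, hi, Fin.snoc, Nat.lt_succ_of_lt hi]
  · simp [extendSeq, Fin.snoc]

lemma sum_potential_amRun_le (hG : G.Connected) (hn : 2 ≤ Fintype.card V) (f : V → ℕ)
    (v₀ : V) (t : ℕ) :
    ∑ g : Fin t → V, potential G (amRun G f (extendSeq v₀ g) t) ≤
      (Fintype.card V - vertexExpansion G / 6) ^ t * potential G f := by
  have hq : 0 ≤ (Fintype.card V : ℝ) - vertexExpansion G / 6 := by
    have := vertexExpansion_le_two (G := G) hn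
    have : (2 : ℝ) ≤ Fintype.card V := by exact_mod_cast hn
    linarith
  induction t with
  | zero => simp [amRun]
  | succ t ih =>
    rw [← (Fin.snocEquiv fun _ : Fin (t + 1) => V).sum_comp, Fintype.sum_prod_type,
      Finset.sum_comm]
    calc _ = ∑ g : Fin t → V, ∑ v,
          potential G (amUpdate G (amRun G f (extendSeq v₀ g) t) v) :=
          Finset.sum_congr rfl fun g _ => Finset.sum_congr rfl fun v _ =>
            congrArg (potential G) (amRun_extendSeq_snoc f v₀ v g)
      _ ≤ ∑ g : Fin t → V, (Fintype.card V - vertexExpansion G / 6) *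
            potential G (amRun G f (extendSeq v₀ g) t) :=
          Finset.sum_le_sum fun g _ => sum_potential_amUpdate_le hG hn _
      _ ≤ _ := by
          rw [← Finset.mul_sum, pow_succ', mul_assoc]
          exact mul_le_mul_of_nonneg_left ih hq

/-- The update sequences for which the valuation is not constant after `t` rounds. -/
def nonconstantAt (G : SimpleGraph V) (f : V → ℕ) (t : ℕ) : Set (ℕ → V) :=
  {ω | ¬ ∃ c : ℕ, amRun G f ω t = fun _ => c}

lemma convTime_le_of_constant {f : V → ℕ} {ω : ℕ → V} {t : ℕ}
    (h : ω ∉ nonconstantAt G f t) : convTime G f ω ≤ t := by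
  have hc : ∃ c : ℕ, amRun G f ω t = fun _ => c := not_not.1 h
  exact iInf₂_le t hc

lemma convTime_le_tsum (f : V → ℕ) (ω : ℕ → V) :
    convTime G f ω ≤ ∑' t, (nonconstantAt G f t).indicator 1 ω := by
  by_cases h : ∃ t, ω ∉ nonconstantAt G f t
  · refine (convTime_le_of_constant (Nat.find_spec h)).trans ?_
    refine le_trans (le_of_eq ?_) (ENNReal.sum_le_tsum (Finset.range (Nat.find h)))
    rw [Finset.sum_congr rfl fun t ht => Set.indicator_of_mem
      (not_not.1 (Nat.find_min h (Finset.mem_range.1 ht))) 1]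
    simp
  · push Not at h
    rw [tsum_congr fun t => Set.indicator_of_mem (h t) 1]
    simp

variable [MeasurableSpace V] {μ : Measure (ℕ → V)}

lemma measurableSet_nonconstantAt [MeasurableSingletonClass V] [Nonempty V] (f : V → ℕ) (t : ℕ) :
    MeasurableSet (nonconstantAt G f t) := by
  obtain ⟨v₀⟩ := ‹Nonempty V›
  have h : nonconstantAt G f t = (fun (ω : ℕ → V) (i : Fin t) => ω i) ⁻¹'
      {g | ¬ ∃ c : ℕ, amRun G f (extendSeq v₀ g) t = fun _ => c} := by
    ext ω
    simp only [nonconstantAt, Set.mem_ofPred_eq, Set.mem_preimage, amRun_extendSeq_restrict]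
  rw [h]
  exact (measurable_pi_lambda _ fun i => measurable_pi_apply _) (Set.toFinite _).measurableSet

lemma measure_nonconstantAt_le (hG : G.Connected) (hn : 2 ≤ Fintype.card V) {f : V → ℕ}
    (hf : ∀ v, f v ≤ Fintype.card V) (hμ : IsUniformProduct μ) (t : ℕ) :
    μ (nonconstantAt G f t) ≤ ENNReal.ofReal ((Fintype.card V : ℝ) ^ 4 *
      (1 - vertexExpansion G / (6 * Fintype.card V)) ^ t) := by
  obtain ⟨v₀⟩ := hG.nonempty
  have hn0 : (0 : ℝ) < Fintype.card V := by exact_mod_cast (by omega : 0 < Fintype.card V)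
  set S : Finset (Fin t → V) := Finset.univ.filter
    (fun g => ¬ ∃ c : ℕ, amRun G f (extendSeq v₀ g) t = fun _ => c) with hS
  have hsub : nonconstantAt G f t ⊆ ⋃ g ∈ S, {ω | ∀ i < t, ω i = extendSeq v₀ g i} := by
    intro ω hω
    refine Set.mem_iUnion₂.2 ⟨fun i => ω i, ?_, fun i hi => by simp [extendSeq, hi]⟩
    rw [hS, Finset.mem_filter, amRun_extendSeq_restrict]
    exact ⟨Finset.mem_univ _, hω⟩
  have hcard : (S.card : ℝ) ≤ Fintype.card V * ((Fintype.card V - vertexExpansion G / 6) ^ t *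
      (Fintype.card V : ℝ) ^ 3) := by
    calc (S.card : ℝ) = ∑ g ∈ S, 1 := by simp
      _ ≤ ∑ g ∈ S, Fintype.card V * potential G (amRun G f (extendSeq v₀ g) t) :=
          Finset.sum_le_sum fun g hg =>
            one_le_card_mul_potential (amRun_le hf _ _) (Finset.mem_filter.1 hg).2
      _ ≤ ∑ g, Fintype.card V * potential G (amRun G f (extendSeq v₀ g) t) :=
          Finset.sum_le_univ_sum_of_nonneg fun g => mul_nonneg hn0.le (potential_nonneg _)
      _ ≤ _ := by
          rw [← Finset.mul_sum]
          have hq : 0 ≤ (Fintype.card V : ℝ) - vertexExpansion G / 6 := by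
            have := vertexExpansion_le_two (G := G) hn
            have : (2 : ℝ) ≤ Fintype.card V := by exact_mod_cast hn
            linarith
          gcongr
          exact (sum_potential_amRun_le hG hn f v₀ t).trans
            (mul_le_mul_of_nonneg_left (potential_le f) (pow_nonneg hq t))
  calc μ (nonconstantAt G f t)
      ≤ ∑ g ∈ S, μ {ω | ∀ i < t, ω i = extendSeq v₀ g i} :=
        (measure_mono hsub).trans (measure_biUnion_finset_le _ _)
    _ = ENNReal.ofReal (S.card * (1 / Fintype.card V) ^ t) := by
        simp only [hμ.2, Finset.sum_const, nsmul_eq_mul]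
        rw [ENNReal.ofReal_mul (by positivity), ENNReal.ofReal_natCast,
          ENNReal.ofReal_pow (by positivity), ENNReal.ofReal_div_of_pos hn0,
          ENNReal.ofReal_natCast, ENNReal.ofReal_one]
    _ ≤ _ := by
        refine ENNReal.ofReal_le_ofReal ?_
        have h1 : (1 : ℝ) - vertexExpansion G / (6 * Fintype.card V) =
            (Fintype.card V - vertexExpansion G / 6) * (1 / Fintype.card V) := by
          field_simp
        rw [h1, mul_pow]
        refine (mul_le_mul_of_nonneg_right hcard (by positivity)).trans (le_of_eq ?_)
        ring

end

lemma pow_mul_one_sub_pow_le_exp {n : ℕ} (hn : 0 < n) {δ : ℝ} (hδ : δ ≤ 1) (t : ℕ) :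
    (n : ℝ) ^ 4 * (1 - δ) ^ t ≤ Real.exp (4 * Real.log n - δ * t) := by
  have h4 : (n : ℝ) ^ 4 = Real.exp (4 * Real.log n) := by
    rw [mul_comm, Real.exp_mul, Real.exp_log (by exact_mod_cast hn)]
    norm_cast
  have hq : (1 - δ) ^ t ≤ Real.exp (-(δ * t)) := by
    rw [← neg_mul, Real.exp_mul, Real.rpow_natCast]
    exact pow_le_pow_left₀ (by linarith) (Real.one_sub_le_exp_neg δ) t
  rw [sub_eq_add_neg (4 * _), Real.exp_add, h4]
  gcongr

lemma half_le_log {n : ℕ} (hn : 2 ≤ n) : 1 / 2 ≤ Real.log n := by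
  have h2 : Real.log 2 ≤ Real.log n := Real.log_le_log two_pos (by exact_mod_cast hn)
  linarith [Real.log_two_gt_d9]

lemma tsum_le_of_geometric_tail {p : ℕ → ℝ≥0∞} {n : ℕ} (hn : 2 ≤ n) {δ : ℝ} (hδ0 : 0 < δ)
    (hδ : δ ≤ 1) (hp1 : ∀ t, p t ≤ 1)
    (hp : ∀ t, p t ≤ ENNReal.ofReal ((n : ℝ) ^ 4 * (1 - δ) ^ t)) :
    ∑' t, p t ≤ ENNReal.ofReal (8 * Real.log n / δ) := by
  have hL := half_le_log hn
  set L := Real.log n with hLdef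
  set t₀ := ⌈4 * L / δ⌉₊ with ht₀
  have hle : 4 * L / δ ≤ t₀ := Nat.le_ceil _
  have hlt : (t₀ : ℝ) < 4 * L / δ + 1 := Nat.ceil_lt_add_one (by positivity)
  have htail : ∀ s, p (s + t₀) ≤ ENNReal.ofReal (1 - δ) ^ s := by
    intro s
    refine (hp _).trans ?_
    rw [← ENNReal.ofReal_pow (by linarith)]
    refine ENNReal.ofReal_le_ofReal ?_
    have h := pow_mul_one_sub_pow_le_exp (by omega : 0 < n) hδ t₀
    have h0 : Real.exp (4 * L - δ * t₀) ≤ 1 := by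
      rw [Real.exp_le_one_iff]
      rw [div_le_iff₀ hδ0] at hle
      linarith
    calc (n : ℝ) ^ 4 * (1 - δ) ^ (s + t₀) = ((n : ℝ) ^ 4 * (1 - δ) ^ t₀) * (1 - δ) ^ s := by ring
      _ ≤ 1 * (1 - δ) ^ s :=
          mul_le_mul_of_nonneg_right (h.trans h0) (pow_nonneg (by linarith) _)
      _ = _ := one_mul _
  rw [← Summable.sum_add_tsum_nat_add' (k := t₀) ENNReal.summable]
  calc ∑ i ∈ Finset.range t₀, p i + ∑' s, p (s + t₀)
      ≤ ∑ i ∈ Finset.range t₀, 1 + ∑' s, ENNReal.ofReal (1 - δ) ^ s := by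
        gcongr with i hi s
        · exact hp1 i
        · exact htail s
    _ = ENNReal.ofReal (t₀ + δ⁻¹) := by
        have h1 : (1 : ℝ≥0∞) - ENNReal.ofReal (1 - δ) = ENNReal.ofReal δ := by
          rw [← ENNReal.ofReal_one, ← ENNReal.ofReal_sub _ (by linarith)]
          congr 1
          ring
        rw [ENNReal.tsum_geometric, h1, ENNReal.ofReal_add (by positivity) (by positivity),
          ENNReal.ofReal_inv_of_pos hδ0, ENNReal.ofReal_natCast]
        simp
    _ ≤ _ := by
        refine ENNReal.ofReal_le_ofReal ?_
        have h1 : 1 ≤ δ⁻¹ := (one_le_inv₀ hδ0).2 hδ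
        rw [div_eq_mul_inv] at hlt ⊢
        nlinarith

lemma exp_tail_le {L x : ℝ} (hL : 1 / 2 ≤ L) (hx : 8 * L < x) :
    Real.exp (4 * L - x + 1) ≤ 4000 * L ^ 2 / (36 * x ^ 2) := by
  have hx0 : 0 < x := by linarith
  have h1 : Real.exp (4 * L - x + 1) ≤ Real.exp 1 / Real.exp (x / 2) := by
    rw [← Real.exp_sub]
    exact Real.exp_le_exp.2 (by linarith)
  have h2 : x ^ 2 / 8 ≤ Real.exp (x / 2) := by
    have := Real.quadratic_le_exp_of_nonneg (x := x / 2) (by positivity)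
    nlinarith
  have h3 : Real.exp 1 ≤ 3 := by linarith [Real.exp_one_lt_d9]
  calc _ ≤ Real.exp 1 / Real.exp (x / 2) := h1
    _ ≤ 3 / (x ^ 2 / 8) := by gcongr
    _ = 864 / (36 * x ^ 2) := by
        field_simp
        norm_num
    _ ≤ _ := by
        gcongr
        nlinarith

/-- there is a constant `C > 0` such that for every finite simple connected
undirected graph `G` on `n ≥ 2` vertices with vertex expansion `φ`, every valuation
`f : V → {1,…,n}` and every `a > 0`, the convergence time `A = T_f` of the asynchronous
maximum model started from `f` satisfies the concentration bound
`P(|A − E[A]| ≥ a) ≤ C·(n/φ)²·(log n)²/a²`  (here `|A − E[A]|` is expressed in `ℝ≥0∞` as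
`max (A - E[A]) (E[A] - A)` with truncated subtraction). -/
theorem convTime_concentration :
    ∃ C : ℝ, 0 < C ∧
      ∀ (V : Type) [Fintype V] [MeasurableSpace V] [MeasurableSingletonClass V]
        (n : ℕ), 2 ≤ n → Fintype.card V = n →
        ∀ (G : SimpleGraph V), G.Connected →
        ∀ (f : V → ℕ), (∀ v, f v ∈ Finset.Icc 1 n) →
        ∀ (μ : Measure (ℕ → V)), IsUniformProduct μ →
        ∀ a : ℝ, 0 < a →
          μ {ω | ENNReal.ofReal a ≤
              max (convTime G f ω - ∫⁻ ω', convTime G f ω' ∂μ)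
                  ((∫⁻ ω', convTime G f ω' ∂μ) - convTime G f ω)} ≤
            ENNReal.ofReal
              (C * ((n : ℝ) / vertexExpansion G) ^ 2 * Real.log n ^ 2 / a ^ 2) := by
  refine ⟨4000, by norm_num, ?_⟩
  intro V _ _ _ n hn hcard G hG f hf μ hμ a ha
  subst hcard
  have := hμ.1
  have := hG.nonempty
  have hf' : ∀ v, f v ≤ Fintype.card V := fun v => (Finset.mem_Icc.1 (hf v)).2
  have hn0 : (2 : ℝ) ≤ Fintype.card V := by exact_mod_cast hn
  have hφ := vertexExpansion_pos hG hn
  have hφ2 := vertexExpansion_le_two (G := G) hn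
  have hL := half_le_log hn
  set N : ℝ := (Fintype.card V : ℝ)
  set L := Real.log N
  obtain ⟨δ, hδ⟩ : ∃ δ, δ = vertexExpansion G / (6 * N) := ⟨_, rfl⟩
  have hδ0 : 0 < δ := by rw [hδ]; positivity
  have hδ1 : δ ≤ 1 := by
    rw [hδ, div_le_one (by positivity)]
    linarith
  have htail : ∀ t, μ (nonconstantAt G f t) ≤ ENNReal.ofReal (N ^ 4 * (1 - δ) ^ t) :=
    fun t => hδ ▸ measure_nonconstantAt_le hG hn hf' hμ t
  have hmean : ∫⁻ ω, convTime G f ω ∂μ ≤ ENNReal.ofReal (8 * L / δ) := by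
    calc ∫⁻ ω, convTime G f ω ∂μ
        ≤ ∫⁻ ω, ∑' t, (nonconstantAt G f t).indicator 1 ω ∂μ :=
          lintegral_mono fun ω => convTime_le_tsum f ω
      _ = ∑' t, μ (nonconstantAt G f t) := by
          rw [lintegral_tsum fun t =>
            (measurable_one.indicator (measurableSet_nonconstantAt f t)).aemeasurable]
          exact tsum_congr fun t => lintegral_indicator_one (measurableSet_nonconstantAt f t)
      _ ≤ _ := tsum_le_of_geometric_tail hn hδ0 hδ1 (fun _ => prob_le_one) htail
  have hrhs : 4000 * (N / vertexExpansion G) ^ 2 * L ^ 2 / a ^ 2 =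
      4000 * L ^ 2 / (36 * (δ * a) ^ 2) := by
    rw [hδ]
    field_simp
    norm_num
  rw [hrhs]
  rcases le_or_gt (δ * a) (8 * L) with hle | hlt
  · refine prob_le_one.trans (ENNReal.one_le_ofReal.2 ?_)
    rw [one_le_div (by positivity)]
    nlinarith [mul_pos hδ0 ha]
  · have hKa : 8 * L / δ < a := (div_lt_iff₀' hδ0).2 hlt
    have hceil := Nat.le_ceil a
    have hpos : 0 < ⌈a⌉₊ := Nat.ceil_pos.2 ha
    obtain ⟨t, ht⟩ : ∃ t, ⌈a⌉₊ = t + 1 := ⟨⌈a⌉₊ - 1, by omega⟩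
    have hta : (t : ℝ) < a := Nat.lt_ceil.1 (by omega)
    have hta' : a ≤ t + 1 := by rw [ht] at hceil; exact_mod_cast hceil
    refine (measure_mono fun ω hω => ?_).trans ((htail t).trans (ENNReal.ofReal_le_ofReal ?_))
    · by_contra hconst
      have h1 : convTime G f ω < ENNReal.ofReal a := by
        refine (convTime_le_of_constant hconst).trans_lt ?_
        rw [← ENNReal.ofReal_natCast]
        exact (ENNReal.ofReal_lt_ofReal_iff ha).2 hta
      have h2 := hmean.trans_lt ((ENNReal.ofReal_lt_ofReal_iff ha).2 hKa)
      exact (max_lt (tsub_le_self.trans_lt h1) (tsub_le_self.trans_lt h2)).not_ge hω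
    · refine (pow_mul_one_sub_pow_le_exp (by omega) hδ1 t).trans
        (le_trans (Real.exp_le_exp.2 ?_) (exp_tail_le hL hlt))
      change 4 * L - δ * t ≤ _
      nlinarith
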